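/- Let p ≥ 3 be a prime and let A be an associative unital algebra over 𝔽_p = ZMod p. Suppose e, f, h ∈ A satisfy the sl₂ commutation relations h*e − e*h = 2·e, h*f − f*h = −2·f, e*f − f*e = h, together with the restricted relations e^p = 0, f^p = 0, h^p = h. Define t = ∑_{k=1}^{p−1} binom(h,k) · f^{p−k} · e^{p−k} · ((p−k)!)^{−2}, where binom(h,k) = (k!)^{−1} · ∏_{m=0}^{k−1} (h − m·1). Then t is idempotent: t² = t. -/

import Mathlib

open Finset in
/-- product over all residues -/
lemma aux_prod (p : ℕ) [Fact p.Prime] {R : Type*} [CommRing R] [Algebra (ZMod p) R] (a : R) :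
    ∏ j ∈ range p, (a - (j : R)) = a ^ p - a := by
  have h1 : (∏ x : ZMod p, (Polynomial.X - Polynomial.C x)) = (Polynomial.X ^ p - Polynomial.X : Polynomial (ZMod p)) := by
    have hr := FiniteField.roots_X_pow_card_sub_X (ZMod p)
    rw [ZMod.card] at hr
    have hp1 : 1 < p := (Fact.out : p.Prime).one_lt
    have := Polynomial.prod_multiset_X_sub_C_of_monic_of_roots_card_eq
      (p := (Polynomial.X ^ p - Polynomial.X : Polynomial (ZMod p)))
      (Polynomial.monic_X_pow_sub (by rw [Polynomial.degree_X]; exact_mod_cast hp1))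
      (by rw [hr, FiniteField.X_pow_card_sub_X_natDegree_eq _ hp1]; simp [ZMod.card])
    rw [hr] at this
    exact this
  have h2 := congrArg (Polynomial.aeval a) h1
  rw [map_prod] at h2
  simp only [map_sub, Polynomial.aeval_X, Polynomial.aeval_C, map_pow] at h2
  rw [← h2]
  refine Finset.prod_nbij' (fun j => (j : ZMod p)) ZMod.val (by simp) (by simp [ZMod.val_lt]) ?_ (by simp) (by simp)
  intro j hj
  exact ZMod.val_cast_of_lt (mem_range.1 hj)

open Finset in
lemma aux_ident {K : Type*} [Field K] (a : K) (ha : ∀ z : ℤ, a + z ≠ 0) (M n : ℕ) (hn : n ≤ M) :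
    ∑ k ∈ range M, ((n.choose (k + 1) : K) * (k.factorial : K) ^ 2) /
      ∏ i ∈ range (k + 1), ((a + i + 1) * (a + n - i)) = ∑ i ∈ range n, 1 / (a + i + 1) ^ 2 := by
  induction n with
  | zero => simp
  | succ n ih =>
    rw [sum_range_succ, ← ih (by omega)]
    let G : ℕ → K := fun k => ((k.factorial : K) ^ 2 * (n.choose k : K)) /
      ((∏ i ∈ range k, ((a + i + 1) * (a + n - i))) * (a + n + 1) ^ 2)
    have hG : ∑ k ∈ range M, (G k - G (k + 1)) = G 0 - G M := sum_range_sub' G M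
    have hG0 : G 0 = 1 / (a + n + 1) ^ 2 := by simp [G]
    have hGM : G M = 0 := by
      simp [G, Nat.choose_eq_zero_of_lt (show n < M by omega)]
    rw [hG0, hGM, sub_zero] at hG
    rw [← hG, ← sum_add_distrib]
    refine sum_congr rfl fun k hk => ?_
    have key : (∏ i ∈ range (k + 1), (a + (n + 1 : ℕ) - i)) = (a + n + 1) * ∏ i ∈ range k, (a + n - i) := by
      rw [prod_range_succ', mul_comm]
      congr 1
      · push_cast; ring
      · refine prod_congr rfl fun i _ => ?_
        push_cast; ring
    have hd : ((k : K) + 1) * (n.choose (k + 1) : K) = (n - k) * (n.choose k : K) := by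
      by_cases hkn : k ≤ n
      · have := Nat.choose_succ_right_eq n k
        have := congrArg (Nat.cast : ℕ → K) this
        push_cast [Nat.cast_sub hkn] at this
        linear_combination this
      · simp [Nat.choose_eq_zero_of_lt (show n < k by omega), Nat.choose_eq_zero_of_lt (show n < k + 1 by omega)]
    have hc : (((n + 1).choose (k + 1) : ℕ) : K) = n.choose k + n.choose (k + 1) := by
      rw [Nat.choose_succ_succ]; push_cast; ring
    simp only [G]
    rw [prod_mul_distrib, key, prod_mul_distrib, prod_mul_distrib, hc, prod_range_succ, prod_range_succ,
      Nat.factorial_succ]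
    have e1 : (∏ i ∈ range k, (a + i + 1)) ≠ 0 := prod_ne_zero_iff.2 fun i _ => by
      have := ha (i + 1); push_cast at this; rwa [← add_assoc] at this
    have e2 : (∏ i ∈ range k, (a + n - i)) ≠ 0 := prod_ne_zero_iff.2 fun i _ => by
      have := ha (n - i); push_cast at this; rwa [← add_sub_assoc] at this
    have e3 : a + n + 1 ≠ 0 := by have := ha (n + 1); push_cast at this; rwa [← add_assoc] at this
    have e4 : a + k + 1 ≠ 0 := by have := ha (k + 1); push_cast at this; rwa [← add_assoc] at this
    have e5 : a + n - k ≠ 0 := by have := ha (n - k); push_cast at this; rwa [← add_sub_assoc] at this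
    generalize (∏ i ∈ range k, (a + (i : K) + 1)) = P at *
    generalize (∏ i ∈ range k, (a + (n : K) - (i : K))) = Q at *
    generalize (n.choose k : K) = c at *
    generalize (n.choose (k + 1) : K) = d at *
    push_cast
    field_simp
    linear_combination (-(a + n - k) * (k.factorial : K) ^ 2) * hd

lemma aux_wilson (p : ℕ) [Fact p.Prime] (k : ℕ) (hk : k + 1 ≤ p) :
    (((p - (k + 1)).factorial : ZMod p) * (k.factorial : ZMod p)) ^ 2 = 1 := by
  induction k with
  | zero => simp [ZMod.wilsons_lemma]
  | succ k ih =>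
    rw [← ih (by omega)]
    obtain ⟨m, hm⟩ : ∃ m, p = m + (k + 2) := ⟨p - (k + 2), by omega⟩
    have h1 : p - (k + 1 + 1) = m := by omega
    have h2 : p - (k + 1) = m + 1 := by omega
    rw [h1, h2, Nat.factorial_succ, Nat.factorial_succ]
    have : ((m + (k + 2) : ℕ) : ZMod p) = 0 := by rw [← hm]; simp
    push_cast at *
    have h3 : (m : ZMod p) + 1 = - (k + 1) := by linear_combination this
    rw [h3]; ring

open Finset in
lemma aux_sum (p : ℕ) [Fact p.Prime] {R : Type*} [CommRing R] [Algebra (ZMod p) R] (x : R) :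
    ∑ c : ZMod p, (1 - (x - algebraMap (ZMod p) R c) ^ (p - 1)) = 1 := by
  have hp1 : 1 < p := (Fact.out : p.Prime).one_lt
  have h0 : (∑ c : ZMod p, (1 - (Polynomial.X - Polynomial.C c) ^ (p - 1)) : Polynomial (ZMod p)) = 1 := by
    refine sub_eq_zero.1 (Polynomial.eq_zero_of_natDegree_lt_card_of_eval_eq_zero' _ univ ?_ ?_)
    · intro b _
      simp only [Polynomial.eval_sub, Polynomial.eval_finsetSum, Polynomial.eval_one, Polynomial.eval_pow,
        Polynomial.eval_X, Polynomial.eval_C]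
      rw [Finset.sum_eq_single b]
      · simp; omega
      · intro c _ hc
        rw [ZMod.pow_card_sub_one_eq_one (sub_ne_zero.2 hc.symm), sub_self]
      · simp
    · rw [card_univ, ZMod.card]
      refine lt_of_le_of_lt (b := p - 1) ?_ (by omega)
      refine (Polynomial.natDegree_sub_le_of_le (Polynomial.natDegree_sum_le_of_forall_le _ _ (n := p - 1) fun c _ => ?_)
        (by simp : Polynomial.natDegree (1 : Polynomial (ZMod p)) ≤ p - 1)).trans (by simp)
      refine (Polynomial.natDegree_sub_le_of_le (m := p - 1) (n := p - 1) (by simp) ?_).trans (by simp)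
      simp
  have h2 := congrArg (Polynomial.aeval x) h0
  simpa only [map_sum, map_sub, Polynomial.aeval_X, Polynomial.aeval_C, map_pow, map_one] using h2

open Finset in
/-- evaluation of t in terms of a parameter -/
noncomputable def auxT (p : ℕ) {R : Type*} [CommRing R] [Algebra (ZMod p) R] (h a : R) : R :=
  ∑ k ∈ range (p - 1), ((((k + 1).factorial : ZMod p))⁻¹ * ((((p - (k + 1)).factorial : ZMod p)) ^ 2)⁻¹) •
    ((∏ m ∈ range (k + 1), (h - (m : R))) * ∏ j ∈ range (p - (k + 1)), ((a - j) * (a + j + h + 1)))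

lemma auxT_map (p : ℕ) {R S : Type*} [CommRing R] [Algebra (ZMod p) R] [CommRing S] [Algebra (ZMod p) S]
    (φ : R →+* S) (h a : R) : φ (auxT p h a) = auxT p (φ h) (φ a) := by
  simp only [auxT, map_sum, ZMod.map_smul, map_mul, map_prod, map_sub, map_natCast, map_add, map_one]

open Finset in
lemma aux_coef (p : ℕ) [Fact p.Prime] {R : Type*} [CommRing R] [Algebra (ZMod p) R] (l : ℕ) (a : R) :
    auxT p (l : R) a = ∑ k ∈ range (p - 1), ((l.choose (k + 1) : R) * (k.factorial : R) ^ 2) *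
      ∏ j ∈ range (p - (k + 1)), ((a - j) * (a + j + l + 1)) := by
  refine sum_congr rfl fun k hk => ?_
  have hk := mem_range.1 hk
  have h1 : ∏ m ∈ range (k + 1), ((l : R) - (m : R)) = ((k + 1).factorial : R) * (l.choose (k + 1) : R) := by
    have : (∏ m ∈ range (k + 1), ((l : ℤ) - (m : ℤ))) = ((k + 1).factorial : ℤ) * (l.choose (k + 1) : ℤ) := by
      rw [← Nat.cast_mul, ← Nat.descFactorial_eq_factorial_mul_choose]
      rw [← descPochhammer_eval_eq_descFactorial, descPochhammer_eval_eq_prod_range]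
    have := congrArg (Int.cast : ℤ → R) this
    push_cast at this
    exact_mod_cast this
  have hf : (((k + 1).factorial : ℕ) : ZMod p) ≠ 0 := by
    rw [Ne, ZMod.natCast_eq_zero_iff, (Fact.out : p.Prime).dvd_factorial]; omega
  have h3 : ((((p - (k + 1)).factorial : ZMod p)) ^ 2)⁻¹ = (k.factorial : ZMod p) ^ 2 := by
    apply inv_eq_of_mul_eq_one_right
    rw [← mul_pow]
    exact aux_wilson p k (by omega)
  have h4 : (((k + 1).factorial : ℕ) : R) = algebraMap (ZMod p) R ((k + 1).factorial : ℕ) := by simp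
  have h5 : ((k.factorial : ℕ) : R) = algebraMap (ZMod p) R (k.factorial : ℕ) := by simp
  rw [h1, h3, Algebra.smul_def, h4, h5, map_mul]
  have h6 : algebraMap (ZMod p) R (((k + 1).factorial : ℕ) : ZMod p)⁻¹ * algebraMap (ZMod p) R ((k + 1).factorial : ℕ) = 1 := by
    rw [← map_mul, inv_mul_cancel₀ hf, map_one]
  rw [map_pow]
  linear_combination ((algebraMap (ZMod p) R (k.factorial : ℕ)) ^ 2 * (l.choose (k + 1) : R) * ∏ j ∈ range (p - (k + 1)), ((a - j) * (a + j + l + 1))) * h6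

lemma aux_p0 (p : ℕ) {R : Type*} [CommRing R] [Algebra (ZMod p) R] : (p : R) = 0 := by
  rw [← map_natCast (algebraMap (ZMod p) R)]; simp

lemma aux_frob (p : ℕ) [Fact p.Prime] {R : Type*} [CommRing R] [Algebra (ZMod p) R] (a b : R) :
    (a + b) ^ p = a ^ p + b ^ p := by
  obtain ⟨r, hr⟩ := exists_add_pow_prime_eq (Fact.out : p.Prime) a b
  rw [hr, aux_p0 p]; ring

lemma aux_natpow (p : ℕ) [Fact p.Prime] {R : Type*} [CommRing R] [Algebra (ZMod p) R] (n : ℕ) :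
    (n : R) ^ p = n := by
  rw [← map_natCast (algebraMap (ZMod p) R), ← map_pow, ZMod.pow_card]

open Finset in
lemma aux_prod2 (p : ℕ) [Fact p.Prime] {R : Type*} [CommRing R] [Algebra (ZMod p) R] (a : R) (l : ℕ) :
    ∏ j ∈ range p, ((a - (j : R)) * (a + j + l + 1)) = (a ^ p - a) ^ 2 := by
  rw [prod_mul_distrib, aux_prod, pow_two]
  congr 1
  have := aux_prod p (a + l)
  rw [aux_frob, aux_natpow, add_sub_add_right_eq_sub] at this
  rw [← this, ← prod_range_reflect]
  refine prod_congr rfl fun j hj => ?_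
  have hj := mem_range.1 hj
  rw [Nat.sub_sub, Nat.cast_sub (by omega), aux_p0 p]
  push_cast; ring

open Finset in
lemma aux_field (p : ℕ) [Fact p.Prime] {K : Type*} [Field K] [Algebra (ZMod p) K] (a : K) (ha : a ^ p - a ≠ 0)
    (l : ℕ) (hl : l < p) :
    auxT p (l : K) a = ∑ i ∈ range l, ((a + i + 1) ^ (p - 1) - 1) ^ 2 := by
  have hp1 : 1 < p := (Fact.out : p.Prime).one_lt
  have hz : ∀ z : ℤ, a + z ≠ 0 := by
    intro z hz
    apply ha
    have h1 : a = algebraMap (ZMod p) K (-z) := by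
      rw [map_neg, map_intCast]; linear_combination hz
    rw [h1, ← map_pow, ZMod.pow_card, sub_self]
  have hI := aux_ident a hz (p - 1) l (by omega)
  have hI2 := congrArg (fun x => (a ^ p - a) ^ 2 * x) hI
  simp only [mul_sum] at hI2
  rw [aux_coef]
  refine Eq.trans (sum_congr rfl fun k hk => ?_) (hI2.trans (sum_congr rfl fun i _ => ?_))
  · have hk := mem_range.1 hk
    have e0 : ∏ i ∈ range (k + 1), ((a + i + 1) * (a + l - i)) ≠ 0 := prod_ne_zero_iff.2 fun i _ => by
      have e1 := hz (i + 1)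
      have e2 := hz (l - i)
      push_cast at e1 e2
      rw [← add_assoc] at e1
      rw [← add_sub_assoc] at e2
      exact mul_ne_zero e1 e2
    have : (∏ j ∈ range (p - (k + 1)), ((a - j) * (a + j + l + 1))) *
        ∏ i ∈ range (k + 1), ((a + i + 1) * (a + l - i)) = (a ^ p - a) ^ 2 := by
      rw [← aux_prod2 p a l]
      conv_rhs => rw [show p = (p - (k + 1)) + (k + 1) by omega, prod_range_add]
      congr 1
      rw [← prod_range_reflect]
      refine prod_congr rfl fun j hj => ?_
      have hj := mem_range.1 hj
      rw [show k + 1 - 1 - j = k - j by omega, Nat.cast_sub (by omega)]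
      push_cast [Nat.cast_sub (show k + 1 ≤ p by omega)]
      rw [aux_p0 p]; ring
    rw [← this]
    field_simp
  · have e1 := hz (i + 1)
    push_cast at e1
    rw [← add_assoc] at e1
    have : (a + i + 1) * ((a + i + 1) ^ (p - 1) - 1) = a ^ p - a := by
      rw [mul_sub, ← pow_succ', Nat.sub_add_cancel hp1.le, aux_frob, aux_frob, aux_natpow]; ring
    rw [← this]
    field_simp

open Finset in
lemma aux_ring (p : ℕ) [Fact p.Prime] {R : Type*} [CommRing R] [Algebra (ZMod p) R] (a : R)
    (l : ℕ) (hl : l < p) :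
    auxT p (l : R) a = ∑ i ∈ range l, ((a + i + 1) ^ (p - 1) - 1) ^ 2 := by
  have hp1 : 1 < p := (Fact.out : p.Prime).one_lt
  have h1 : auxT p (l : Polynomial (ZMod p)) Polynomial.X =
      ∑ i ∈ range l, ((Polynomial.X + (i : Polynomial (ZMod p)) + 1) ^ (p - 1) - 1) ^ 2 := by
    apply IsFractionRing.injective (Polynomial (ZMod p)) (FractionRing (Polynomial (ZMod p)))
    rw [auxT_map, map_natCast, aux_field p _ _ l hl]
    · simp
    · rw [← map_pow, ← map_sub]
      intro h
      rw [FaithfulSMul.algebraMap_eq_zero_iff] at h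
      exact FiniteField.X_pow_card_sub_X_ne_zero (ZMod p) hp1 h
  have h2 := congrArg (Polynomial.aeval a : Polynomial (ZMod p) →ₐ[ZMod p] R).toRingHom h1
  rw [auxT_map] at h2
  simpa using h2

open Finset in
lemma aux_final (p : ℕ) [Fact p.Prime] (hp3 : 3 ≤ p) {R : Type*} [CommRing R] [Algebra (ZMod p) R] (a : R)
    (l : ℕ) (hl : l < p) (h0 : ∏ j ∈ range p, ((a - (j : R)) * (a + j + l + 1)) = 0) :
    auxT p (l : R) a ^ 2 = auxT p (l : R) a := by
  rw [aux_prod2] at h0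
  rw [aux_ring p a l hl]
  have hb : ∀ i : ℕ, (a + i + 1) * ((a + i + 1) ^ (p - 1) - 1) = a ^ p - a := fun i => by
      rw [mul_sub, ← pow_succ', Nat.sub_add_cancel (by omega), aux_frob, aux_frob, aux_natpow]; ring
  rw [pow_two, sum_mul_sum]
  refine sum_congr rfl fun i hi => ?_
  have hi := mem_range.1 hi
  rw [sum_eq_single i]
  · have e : (a + i + 1) ^ (p - 1) = (a + i + 1) ^ 2 * (a + i + 1) ^ (p - 3) := by
      rw [← pow_add]; congr 1; omega
    have h1 := hb i
    have h2 : ((a + i + 1) * ((a + i + 1) ^ (p - 1) - 1)) ^ 2 = 0 := by rw [h1, h0]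
    have h3 : ((a + i + 1) ^ (p - 1) - 1) ^ 2 * (a + i + 1) ^ (p - 1) = 0 := by
      rw [mul_pow] at h2
      conv_lhs => rhs; rw [e]
      linear_combination (a + i + 1) ^ (p - 3) * h2
    linear_combination ((a + i + 1) ^ (p - 1) - 2) * h3
  · intro j hj hji
    have hj := mem_range.1 hj
    have h1 := hb i
    have h2 := hb j
    generalize (a + i + 1) ^ (p - 1) - 1 = u at *
    generalize (a + j + 1) ^ (p - 1) - 1 = v at *
    have h3 : ((i : R) - j) ^ 2 * (u ^ 2 * v ^ 2) = 0 := by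
      have : ((i : R) - j) * (u * v) = (a ^ p - a) * (v - u) := by linear_combination v * h1 - u * h2
      linear_combination (((i : R) - j) * (u * v) + (a ^ p - a) * (v - u)) * this + (v - u) ^ 2 * h0
    have h4 : (i : ZMod p) - j ≠ 0 := by
      intro h
      have h := (ZMod.natCast_eq_natCast_iff' i j p).1 (sub_eq_zero.1 h)
      rw [Nat.mod_eq_of_lt (by omega), Nat.mod_eq_of_lt (by omega)] at h
      exact hji h.symm
    have h5 : IsUnit ((i : R) - j) := by
      have := (IsUnit.mk0 _ h4).map (algebraMap (ZMod p) R)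
      simpa using this
    exact (h5.pow 2).mul_right_eq_zero.1 h3
  · intro h; exact absurd (mem_range.2 hi) h

open Finset in
lemma aux_comm_a (p : ℕ) [Fact p.Prime] (hp3 : 3 ≤ p) {R : Type*} [CommRing R] [Algebra (ZMod p) R] (a h : R)
    (rh : h ^ p = h) (h0 : ∏ j ∈ range p, ((a - (j : R)) * (a + j + h + 1)) = 0) :
    auxT p h a ^ 2 = auxT p h a := by
  rw [← sub_eq_zero]
  set y := auxT p h a ^ 2 - auxT p h a with hy
  have key : ∀ c : ZMod p, (1 - (h - algebraMap (ZMod p) R c) ^ (p - 1)) * y = 0 := by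
    intro c
    have hmem : y ∈ Ideal.span {h - algebraMap (ZMod p) R c} := by
      rw [← Ideal.Quotient.eq_zero_iff_mem]
      have hq : Ideal.Quotient.mk (Ideal.span {h - algebraMap (ZMod p) R c}) h =
          ((c.val : ℕ) : R ⧸ Ideal.span {h - algebraMap (ZMod p) R c}) := by
        rw [← map_natCast (Ideal.Quotient.mk _), Ideal.Quotient.eq]
        have : ((c.val : ℕ) : R) = algebraMap (ZMod p) R c := by
          rw [← map_natCast (algebraMap (ZMod p) R)]; simp
        rw [this]
        exact Ideal.mem_span_singleton_self _
      have h1 := congrArg (Ideal.Quotient.mk (Ideal.span {h - algebraMap (ZMod p) R c})) h0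
      rw [map_prod] at h1
      simp only [map_mul, map_sub, map_add, map_natCast, map_one, map_zero, hq] at h1
      have := aux_final p hp3 _ c.val (ZMod.val_lt c) h1
      rw [hy, map_sub, map_pow, auxT_map, hq, this, sub_self]
    obtain ⟨z, hz⟩ := Ideal.mem_span_singleton.1 hmem
    have h2 : (h - algebraMap (ZMod p) R c) ^ p = h - algebraMap (ZMod p) R c := by
      rw [sub_eq_add_neg, aux_frob, rh, ← map_neg, ← map_pow, ZMod.pow_card]
    have h3 : (h - algebraMap (ZMod p) R c) ^ (p - 1) * (h - algebraMap (ZMod p) R c) = h - algebraMap (ZMod p) R c := by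
      rw [← pow_succ, Nat.sub_add_cancel (by omega), h2]
    rw [hz]
    linear_combination -z * h3
  have := aux_sum p h
  rw [← one_mul y, ← this, sum_mul]
  exact sum_eq_zero fun c _ => key c

open Finset in
/-- t in terms of the weight and `X = f e`. -/
noncomputable def auxU (p : ℕ) {R : Type*} [CommRing R] [Algebra (ZMod p) R] (h x : R) : R :=
  ∑ k ∈ range (p - 1), ((((k + 1).factorial : ZMod p))⁻¹ * ((((p - (k + 1)).factorial : ZMod p)) ^ 2)⁻¹) •
    ((∏ m ∈ range (k + 1), (h - (m : R))) * ∏ j ∈ range (p - (k + 1)), (x - j * (h + j + 1)))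

lemma auxU_map (p : ℕ) {R S : Type*} [CommRing R] [Algebra (ZMod p) R] [CommRing S] [Algebra (ZMod p) S]
    (φ : R →+* S) (h a : R) : φ (auxU p h a) = auxU p (φ h) (φ a) := by
  simp only [auxU, map_sum, ZMod.map_smul, map_mul, map_prod, map_sub, map_natCast, map_add, map_one]

open Finset in
lemma aux_comm (p : ℕ) [Fact p.Prime] (hp3 : 3 ≤ p) {R : Type*} [CommRing R] [Algebra (ZMod p) R] (x h : R)
    (rh : h ^ p = h) (h0 : ∏ j ∈ range p, (x - (j : R) * (h + j + 1)) = 0) :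
    auxU p h x ^ 2 = auxU p h x := by
  nontriviality R
  let g : Polynomial R := Polynomial.X ^ 2 + Polynomial.C (h + 1) * Polynomial.X - Polynomial.C x
  have hgd : g.degree = 2 := by simp only [g]; compute_degree!
  have hgm : g.Monic := by simp only [g]; monicity!
  have hinj : Function.Injective (AdjoinRoot.of g) := by
    rw [injective_iff_map_eq_zero]
    intro r hr
    by_contra hr0
    have : g ∣ Polynomial.C r := by
      rw [← AdjoinRoot.mk_eq_zero]; exact hr
    refine hgm.not_dvd_of_degree_lt (Polynomial.C_ne_zero.2 hr0) ?_ this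
    rw [hgd, Polynomial.degree_C hr0]; norm_num
  have ha : AdjoinRoot.of g x = AdjoinRoot.root g * (AdjoinRoot.root g + AdjoinRoot.of g h + 1) := by
    have := AdjoinRoot.eval₂_root g
    simp only [g, Polynomial.eval₂_sub, Polynomial.eval₂_add, Polynomial.eval₂_mul, Polynomial.eval₂_pow,
      Polynomial.eval₂_X, Polynomial.eval₂_C, Polynomial.eval₂_one, map_add, map_one] at this
    linear_combination -this
  have hfac : ∀ j : ℕ, AdjoinRoot.of g x - (j : AdjoinRoot g) * (AdjoinRoot.of g h + j + 1) =
      (AdjoinRoot.root g - j) * (AdjoinRoot.root g + j + AdjoinRoot.of g h + 1) := by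
    intro j; rw [ha]; ring
  apply hinj
  rw [map_pow, auxU_map]
  have hUT : auxU p (AdjoinRoot.of g h) (AdjoinRoot.of g x) = auxT p (AdjoinRoot.of g h) (AdjoinRoot.root g) := by
    simp only [auxU, auxT, hfac]
  rw [hUT]
  apply aux_comm_a p hp3
  · rw [← map_pow, rh]
  · have h1 := congrArg (AdjoinRoot.of g) h0
    rw [map_prod] at h1
    simp only [map_mul, map_sub, map_add, map_natCast, map_one, map_zero, hfac] at h1
    exact h1

lemma aux_exists.{u} (p : ℕ) {A : Type u} [Ring A] [Algebra (ZMod p) A] (h x : A) (hc : h * x = x * h) :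
    ∃ (S : Type u) (_ : CommRing S) (_ : Algebra (ZMod p) S) (φ : S →+* A) (h' x' : S),
      Function.Injective φ ∧ φ h' = h ∧ φ x' = x := by
  have hcomm : ∀ a ∈ ({h, x} : Set A), ∀ b ∈ ({h, x} : Set A), a * b = b * a := by
    rintro a (rfl | rfl) b (rfl | rfl) <;> first | rfl | exact hc | exact hc.symm
  have := Algebra.isMulCommutative_adjoin (ZMod p) hcomm
  have mul_comm' : ∀ u v : Algebra.adjoin (ZMod p) {h, x}, u * v = v * u := fun u v => this.is_comm.comm u v
  refine ⟨Algebra.adjoin (ZMod p) {h, x},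
    { (inferInstance : Ring (Algebra.adjoin (ZMod p) {h, x})) with mul_comm := mul_comm' },
    inferInstance, (Algebra.adjoin (ZMod p) {h, x}).val.toRingHom,
    ⟨h, Algebra.subset_adjoin (by simp)⟩, ⟨x, Algebra.subset_adjoin (by simp)⟩, Subtype.val_injective, rfl, rfl⟩

theorem stmt0 (p : ℕ) (hp : p.Prime) (hp3 : 3 ≤ p)
    (A : Type*) [Ring A] [Algebra (ZMod p) A]
    (e f h : A)
    (rel1 : h * e - e * h = 2 * e)
    (rel2 : h * f - f * h = -2 * f)
    (rel3 : e * f - f * e = h)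
    (re : e ^ p = 0) (rf : f ^ p = 0) (rh : h ^ p = h)
    (t : A)
    (ht : t = ∑ k ∈ Finset.Icc 1 (p - 1),
      ((((k.factorial : ZMod p))⁻¹ * ((((p - k).factorial : ZMod p)) ^ 2)⁻¹) •
        (((List.range k).map (fun m : ℕ => h - (m : A))).prod * f ^ (p - k) * e ^ (p - k)))) :
    t ^ 2 = t := by
  have : Fact p.Prime := ⟨hp⟩
  have r1 : h * e = e * h + 2 * e := by rw [← rel1]; abel
  have r2 : h * f = f * h - 2 * f := by
    rw [sub_eq_iff_eq_add] at rel2; rw [rel2]; noncomm_ring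
  have r3 : e * f = f * e + h := by rw [← rel3]; abel
  have hc : h * (f * e) = (f * e) * h := by
    rw [← mul_assoc, r2, sub_mul, mul_assoc, r1]; noncomm_ring
  have hfn : ∀ n : ℕ, f ^ n * h = (h + 2 * n) * f ^ n := by
    intro n
    induction n with
    | zero => simp
    | succ n ih =>
      have r2' : f * h = h * f + 2 * f := by rw [r2]; abel
      rw [pow_succ, mul_assoc, r2', mul_add, ← mul_assoc, ih]
      have : f ^ n * (2 * f) = 2 * (f ^ n * f) := by noncomm_ring
      rw [this]; push_cast
      noncomm_ring
  have hef : ∀ n : ℕ, (f * e) * f ^ n = f ^ (n + 1) * e + n * (h + n + 1) * f ^ n := by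
    intro n
    induction n with
    | zero => simp
    | succ n ih =>
      have : f ^ (n + 1) * e * f = f ^ (n + 2) * e + f ^ (n + 1) * h := by
        rw [mul_assoc, r3, mul_add, ← mul_assoc, ← pow_succ]
      rw [pow_succ f n, ← mul_assoc, ih, add_mul, this, hfn, mul_assoc (_ * _), ← pow_succ, add_assoc, ← add_mul]
      congr 2
      push_cast
      have hn : (n : A) * h = h * n := (Nat.cast_commute n h).eq
      simp only [mul_add, add_mul, mul_one, one_mul, hn]
      noncomm_ring
      simp only [two_smul, one_add_one_eq_two]
      abel
  have hP : ∀ n : ℕ, f ^ (n + 1) * e ^ (n + 1) = (f * e - n * (h + n + 1)) * (f ^ n * e ^ n) := by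
    intro n
    rw [pow_succ' e, ← mul_assoc, ← mul_assoc, sub_mul, hef, add_sub_cancel_right]
  obtain ⟨S, _, _, φ, h', x', hinj, hh, hx⟩ := aux_exists p h (f * e) hc
  have hprod : ∀ n : ℕ, φ (∏ j ∈ Finset.range n, (x' - (j : S) * (h' + j + 1))) = f ^ n * e ^ n := by
    intro n
    induction n with
    | zero => simp
    | succ n ih =>
      rw [Finset.prod_range_succ, mul_comm, map_mul, ih, hP]
      simp [hh, hx]
  have hlist : ∀ k : ℕ, φ (∏ m ∈ Finset.range k, (h' - (m : S))) =
      ((List.range k).map (fun m : ℕ => h - (m : A))).prod := by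
    intro k
    induction k with
    | zero => simp
    | succ k ih =>
      rw [Finset.prod_range_succ, map_mul, ih, List.range_succ]
      simp [hh]
  have ht' : t = φ (auxU p h' x') := by
    rw [ht, auxU, map_sum, ← Finset.Ico_add_one_right_eq_Icc, Finset.sum_Ico_eq_sum_range]
    simp only [ZMod.map_smul, map_mul φ, hprod, hlist]
    rw [Nat.add_sub_cancel]
    refine Finset.sum_congr rfl fun k _ => ?_
    rw [add_comm 1 k, mul_assoc]
  rw [ht', ← map_pow, aux_comm p hp3 x' h']
  · apply hinj; rw [map_pow, hh, rh]
  · apply hinj; rw [hprod, rf, map_zero, zero_mul]
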